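/- Let σ be an absolutely continuous probability measure on ℝⁿ with finite second moment, μ a probability measure on ℝⁿ with finite second moment, and P = [θ₁, …, θₙ] ∈ O(n). Let T(x) = Σᵢ₌₁ⁿ fᵢ(⟨x, θᵢ⟩) θᵢ, where each fᵢ : ℝ → ℝ is a strictly increasing continuous bijection of ℝ, and assume T_♯μ has finite second moment. Then T_{σ,T_♯μ;P} = T ∘ T_{σ,μ;P} holds σ-almost everywhere, and consequently (T_{σ,T_♯μ;P})_♯σ = T_♯((T_{σ,μ;P})_♯σ); i.e., the slice-matching operator 𝒰(σ, μ, P) := (T_{σ,μ;P})_♯σ is equivariant under the action of such P-compatible maps on the target measure. -/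

import Mathlib

open MeasureTheory Filter
open scoped ENNReal RealInnerProductSpace BigOperators Topology

noncomputable section

namespace SliceMatching

/-- `ℝⁿ` with its Euclidean structure. -/
abbrev Rn (n : ℕ) := EuclideanSpace ℝ (Fin n)

/-- The cumulative distribution function of a measure on `ℝ`. -/
def cdf (ν : Measure ℝ) (t : ℝ) : ℝ := (ν (Set.Iic t)).toReal

/-- The quantile function (pseudo-inverse of the CDF) of a measure on `ℝ`. -/
def quantile (ρ : Measure ℝ) (p : ℝ) : ℝ := sInf {t : ℝ | p ≤ cdf ρ t}

/-- The one-dimensional optimal transport map `T_ν^ρ = F_ρ⁻¹ ∘ F_ν`. -/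
def otMap1d (ν ρ : Measure ℝ) (t : ℝ) : ℝ := quantile ρ (cdf ν t)

/-- The slice `σ^θ`: pushforward of `σ` under the projection `x ↦ ⟪x, θ⟫`. -/
def slice {n : ℕ} (σ : Measure (Rn n)) (θ : Rn n) : Measure ℝ :=
  σ.map (fun x => ⟪x, θ⟫)

/-- The matrix-slice matching map `T_{σ,μ;P}`, where `P ∈ O(n)` has columns `θ 0, …, θ (n-1)`:
`T_{σ,μ;P}(x) = ∑ i, T_{σ^{θ i}}^{μ^{θ i}}(⟪x, θ i⟫) • θ i`. -/
def smMap {n : ℕ} (σ μ : Measure (Rn n)) (θ : Fin n → Rn n) (x : Rn n) : Rn n :=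
  ∑ i, otMap1d (slice σ (θ i)) (slice μ (θ i)) ⟪x, θ i⟫ • θ i

/-- The squared quadratic Wasserstein distance: the infimum of `∫ ‖x - y‖²` over all
couplings of `σ` and `μ`. -/
def W2sq {α : Type*} [MeasurableSpace α] [NormedAddCommGroup α] (σ μ : Measure α) : ℝ :=
  (⨅ (π : Measure (α × α)) (_ : π.map Prod.fst = σ ∧ π.map Prod.snd = μ),
    ∫⁻ p, ENNReal.ofReal (‖p.1 - p.2‖ ^ 2) ∂π).toReal

/-- The quadratic Wasserstein distance `W₂`. -/
def W2 {α : Type*} [MeasurableSpace α] [NormedAddCommGroup α] (σ μ : Measure α) : ℝ :=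
  Real.sqrt (W2sq σ μ)

/-- A set covered, up to at most one point, by open null sets indexed by its points is null. -/
lemma measure_eq_zero_of_open_cover (ν : Measure ℝ) [NullSingletonClass ν] (s : Set ℝ)
    (U : ℝ → Set ℝ) (hU : ∀ t ∈ s, IsOpen (U t)) (h0 : ∀ t ∈ s, ν (U t) = 0)
    (hs : (s \ ⋃ t ∈ s, U t).Subsingleton) : ν s = 0 := by
  obtain ⟨c, hcs, hc, hcU⟩ := TopologicalSpace.isOpen_biUnion_countable s U hU
  have h1 : ν (⋃ t ∈ s, U t) = 0 := by
    rw [← hcU]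
    exact (measure_biUnion_null_iff hc).2 fun t ht => h0 t (hcs ht)
  exact measure_mono_null (Set.sdiff_subset_iff.1 subset_rfl)
    (measure_union_null h1 (hs.measure_zero ν))

lemma cdf_eq (ν : Measure ℝ) [IsProbabilityMeasure ν] :
    cdf ν = ProbabilityTheory.cdf ν :=
  funext fun t => (ProbabilityTheory.cdf_eq_real ν t).symm

lemma monotone_cdf (ν : Measure ℝ) [IsProbabilityMeasure ν] : Monotone (cdf ν) := by
  rw [cdf_eq]
  exact ProbabilityTheory.monotone_cdf ν

/-- The CDF of an atomless probability measure takes values in `(0, 1)` almost everywhere. -/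
lemma ae_cdf_mem_Ioo (ν : Measure ℝ) [IsProbabilityMeasure ν] [NullSingletonClass ν] :
    ∀ᵐ t ∂ν, cdf ν t ∈ Set.Ioo 0 1 := by
  have h0 : ν {t | ν (Set.Iic t) = 0} = 0 := by
    refine measure_eq_zero_of_open_cover ν _ Set.Iio (fun _ _ => isOpen_Iio)
      (fun t ht => measure_mono_null Set.Iio_subset_Iic_self ht) ?_
    rintro a ⟨ha, ha'⟩ b ⟨hb, hb'⟩
    simp only [Set.mem_iUnion, Set.mem_Iio, not_exists, not_lt] at ha' hb'
    exact le_antisymm (hb' a ha) (ha' b hb)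
  have h1 : ν {t | ν (Set.Ioi t) = 0} = 0 := by
    refine measure_eq_zero_of_open_cover ν _ Set.Ioi (fun _ _ => isOpen_Ioi)
      (fun t ht => ht) ?_
    rintro a ⟨ha, ha'⟩ b ⟨hb, hb'⟩
    simp only [Set.mem_iUnion, Set.mem_Ioi, not_exists, not_lt] at ha' hb'
    exact le_antisymm (ha' b hb) (hb' a ha)
  filter_upwards [measure_eq_zero_iff_ae_notMem.1 h0, measure_eq_zero_iff_ae_notMem.1 h1]
    with t ht0 ht1
  refine ⟨ENNReal.toReal_pos ht0 (measure_ne_top _ _), ?_⟩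
  refine lt_of_le_of_ne (measureReal_le_one (μ := ν) (s := Set.Iic t)) fun h => ht1 ?_
  have h2 : ν (Set.Iic t) = 1 := by
    rw [← ENNReal.ofReal_toReal (measure_ne_top ν (Set.Iic t))]
    exact (congrArg ENNReal.ofReal h).trans ENNReal.ofReal_one
  simpa using (prob_compl_eq_zero_iff (μ := ν) measurableSet_Iic).2 h2

lemma nonempty_setOf_le_cdf (ρ : Measure ℝ) [IsProbabilityMeasure ρ] {p : ℝ} (hp : p < 1) :
    {t : ℝ | p ≤ cdf ρ t}.Nonempty := by
  rw [cdf_eq]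
  exact ((ProbabilityTheory.tendsto_cdf_atTop ρ).eventually_const_le hp).exists

lemma bddBelow_setOf_le_cdf (ρ : Measure ℝ) [IsProbabilityMeasure ρ] {p : ℝ} (hp : 0 < p) :
    BddBelow {t : ℝ | p ≤ cdf ρ t} := by
  obtain ⟨a, ha⟩ := ((ProbabilityTheory.tendsto_cdf_atBot ρ).eventually_lt_const hp).exists
  rw [← cdf_eq] at ha
  exact ⟨a, fun t ht => (lt_of_not_ge fun h =>
    (ht.trans (monotone_cdf ρ h)).not_gt ha).le⟩

lemma monotoneOn_quantile (ρ : Measure ℝ) [IsProbabilityMeasure ρ] :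
    MonotoneOn (quantile ρ) (Set.Ioo 0 1) := fun _ hp _ hq hpq =>
  csInf_le_csInf (bddBelow_setOf_le_cdf ρ hp.1) (nonempty_setOf_le_cdf ρ hq.2)
    fun _ ht => hpq.trans ht

/-- Quantiles commute with pushforward under an increasing continuous bijection. -/
lemma quantile_map (ρ : Measure ℝ) [IsProbabilityMeasure ρ] {g : ℝ → ℝ} (hg : StrictMono g)
    (hgc : Continuous g) (hgs : Function.Surjective g) {p : ℝ} (hp : p ∈ Set.Ioo (0 : ℝ) 1) :
    quantile (ρ.map g) p = g (quantile ρ p) := by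
  have hcdf (t : ℝ) : cdf (ρ.map g) (g t) = cdf ρ t := by
    have : g ⁻¹' Set.Iic (g t) = Set.Iic t := by
      ext s
      simp [hg.le_iff_le]
    rw [cdf, Measure.map_apply hgc.measurable measurableSet_Iic, this, cdf]
  rw [quantile, quantile, Monotone.map_csInf_of_continuousAt hgc.continuousAt hg.monotone
    (nonempty_setOf_le_cdf ρ hp.2) (bddBelow_setOf_le_cdf ρ hp.1)]
  congr 1
  ext s
  obtain ⟨t, rfl⟩ := hgs s
  simp [hcdf, hg.injective.eq_iff]

lemma otMap1d_map_ae_eq (ν ρ : Measure ℝ) [IsProbabilityMeasure ν] [NullSingletonClass ν]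
    [IsProbabilityMeasure ρ] {g : ℝ → ℝ} (hg : StrictMono g) (hgc : Continuous g)
    (hgs : Function.Surjective g) :
    otMap1d ν (ρ.map g) =ᵐ[ν] g ∘ otMap1d ν ρ := by
  filter_upwards [ae_cdf_mem_Ioo ν] with t ht
  exact quantile_map ρ hg hgc hgs ht

lemma aemeasurable_otMap1d (ν ρ : Measure ℝ) [IsProbabilityMeasure ν] [NullSingletonClass ν]
    [IsProbabilityMeasure ρ] : AEMeasurable (otMap1d ν ρ) ν := by
  have hm : MeasurableSet (cdf ν ⁻¹' Set.Ioo 0 1) :=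
    (monotone_cdf ν).measurable measurableSet_Ioo
  have hr : ν.restrict (cdf ν ⁻¹' Set.Ioo 0 1) = ν :=
    Measure.restrict_eq_self_of_ae_mem (ae_cdf_mem_Ioo ν)
  have : MonotoneOn (otMap1d ν ρ) (cdf ν ⁻¹' Set.Ioo 0 1) := fun s hs t ht hst =>
    monotoneOn_quantile ρ hs ht (monotone_cdf ν hst)
  have h := aemeasurable_restrict_of_monotoneOn (μ := ν) hm this
  rwa [hr] at h

lemma measurable_inner_right {n : ℕ} (v : Rn n) : Measurable fun x : Rn n => ⟪x, v⟫ := by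
  fun_prop

instance isProbabilityMeasure_slice {n : ℕ} (σ : Measure (Rn n)) [IsProbabilityMeasure σ]
    (v : Rn n) : IsProbabilityMeasure (slice σ v) :=
  Measure.isProbabilityMeasure_map (measurable_inner_right v).aemeasurable

/-- Slices of an absolutely continuous measure in a nonzero direction have no atoms. -/
lemma nullSingletonClass_slice {n : ℕ} {σ : Measure (Rn n)} (hac : σ ≪ volume) {v : Rn n}
    (hv : v ≠ 0) : NullSingletonClass (slice σ v) := by
  refine ⟨fun c => ?_⟩
  rw [slice, Measure.map_apply (measurable_inner_right v) (measurableSet_singleton c)]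
  refine hac ?_
  have hsurj : Function.Surjective (innerₗ (Rn n) v) := by
    refine LinearMap.surjective fun h => hv ?_
    simpa using LinearMap.congr_fun h v
  have h := (ae_comp_linearMap_mem_iff (innerₗ (Rn n) v) volume volume hsurj
    (measurableSet_singleton c).compl).2
    (measure_eq_zero_iff_ae_notMem.1 (measure_singleton c))
  rw [measure_eq_zero_iff_ae_notMem]
  filter_upwards [h] with x hx
  simpa [real_inner_comm] using hx

/-- Slicing along a basis direction turns a compatible map into its coordinate map. -/
lemma slice_map {n : ℕ} (μ : Measure (Rn n)) {θ : Fin n → Rn n} (hθ : Orthonormal ℝ θ)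
    {f : Fin n → ℝ → ℝ} (hf : ∀ i, Continuous (f i)) {T : Rn n → Rn n}
    (hTm : Measurable T) (hT : ∀ x, T x = ∑ i, f i ⟪x, θ i⟫ • θ i) (i : Fin n) :
    slice (μ.map T) (θ i) = (slice μ (θ i)).map (f i) := by
  rw [slice, slice, Measure.map_map (measurable_inner_right _) hTm,
    Measure.map_map (hf i).measurable (measurable_inner_right _)]
  congr 1
  ext x
  simp only [Function.comp_apply, hT]
  exact hθ.inner_left_fintype _ i

/-- Equivariance of the slice-matching operator
`𝒰(σ, μ, P) = (T_{σ,μ;P})_♯σ` under `P`-compatible actions on the target measure. -/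
theorem stmt3 {n : ℕ}
    (σ μ : Measure (Rn n)) [IsProbabilityMeasure σ] [IsProbabilityMeasure μ]
    (hac : σ ≪ volume)
    (hσ2 : Integrable (fun x => ‖x‖ ^ 2) σ) (hμ2 : Integrable (fun y => ‖y‖ ^ 2) μ)
    (θ : Fin n → Rn n) (hθ : Orthonormal ℝ θ)
    (f : Fin n → ℝ → ℝ)
    (hf : ∀ i, StrictMono (f i) ∧ Continuous (f i) ∧ Function.Bijective (f i))
    (T : Rn n → Rn n) (hT : ∀ x, T x = ∑ i, f i ⟪x, θ i⟫ • θ i)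
    (hT2 : Integrable (fun y => ‖y‖ ^ 2) (μ.map T)) :
    smMap σ (μ.map T) θ =ᵐ[σ] T ∘ (smMap σ μ θ) ∧
    σ.map (smMap σ (μ.map T) θ) = (σ.map (smMap σ μ θ)).map T := by
  have hfc : ∀ i, Continuous (f i) := fun i => (hf i).2.1
  have hTm : Measurable T := by
    rw [funext hT]
    exact (continuous_finsetSum _ fun i _ =>
      ((hfc i).comp (continuous_id.inner continuous_const)).smul continuous_const).measurable
  have hatom (i : Fin n) : NullSingletonClass (slice σ (θ i)) :=
    nullSingletonClass_slice hac (hθ.ne_zero i)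
  have hcoord : ∀ᵐ x ∂σ, ∀ i, otMap1d (slice σ (θ i)) (slice (μ.map T) (θ i)) ⟪x, θ i⟫ =
      f i (otMap1d (slice σ (θ i)) (slice μ (θ i)) ⟪x, θ i⟫) := by
    refine ae_all_iff.2 fun i => ?_
    rw [slice_map μ hθ hfc hTm hT]
    exact ae_of_ae_map (measurable_inner_right (θ i)).aemeasurable
      (otMap1d_map_ae_eq (slice σ (θ i)) (slice μ (θ i)) (hf i).1 (hfc i) (hf i).2.2.surjective)
  have hae : smMap σ (μ.map T) θ =ᵐ[σ] T ∘ smMap σ μ θ := by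
    filter_upwards [hcoord] with x hx
    rw [Function.comp_apply, hT, smMap]
    refine Finset.sum_congr rfl fun i _ => ?_
    rw [hx i, smMap, hθ.inner_left_fintype _ i, conj_trivial]
  have hm : AEMeasurable (smMap σ μ θ) σ :=
    Finset.aemeasurable_fun_sum _ fun i _ =>
      ((aemeasurable_otMap1d (slice σ (θ i)) (slice μ (θ i))).comp_measurable
        (measurable_inner_right (θ i))).smul_const (θ i)
  refine ⟨hae, ?_⟩
  rw [Measure.map_congr hae, AEMeasurable.map_map_of_aemeasurable hTm.aemeasurable hm]

end SliceMatching
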